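/- Let u be a λ-eigenfunction of −Δ on K. Then there exists m₀ ≥ 1 such that for every m ≥ m₀ the restriction u_m is an eigenfunction of −Δ_m, say with eigenvalue λ_m, and these satisfy: λ_m = R(λ_{m+1}) for all m ≥ m₀; λ = lim_{m→∞} 15^m λ_m; and there exists m₁ ≥ m₀ with λ_{m+1} = φ₁(λ_m) for all m ≥ m₁. Moreover, if m₀ is taken minimal, then λ_{m₀} ∈ {0, 1, 3, 5} if m₀ = 1 and λ_{m₀} ∈ {1, 3} if m₀ > 1. -/

import Mathlib

open scoped BigOperators

noncomputable section

namespace VNLE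

/-- `N_m = 2·5^m`, the number of points on the circle at level `m`. -/
def Nm (m : ℕ) : ℕ := 2 * 5 ^ m

/-- The partner of a vertex `n` of `K_m`: writing the representative `v` of `n`
(taking `v = 2·5^m` when `n = 0`) as `v = 5^k·a` with `5 ∤ a`, the partner is
`n + 5^k` if `a ≡ 1` or `3 (mod 5)`, and `n - 5^k` if `a ≡ 2` or `4 (mod 5)`.
This realizes the identifications `5^k(1+5j) ∼ 5^k(2+5j)` and
`5^k(3+5j) ∼ 5^k(4+5j)` in `ℤ/(2·5^m)ℤ`. -/
def partner (m : ℕ) (n : ZMod (Nm m)) : ZMod (Nm m) :=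
  let v : ℕ := if n.val = 0 then Nm m else n.val
  let k : ℕ := padicValNat 5 v
  if (v / 5 ^ k) % 5 = 1 ∨ (v / 5 ^ k) % 5 = 3 then n + ((5 ^ k : ℕ) : ZMod (Nm m))
  else n - ((5 ^ k : ℕ) : ZMod (Nm m))

/-- A function on `K_m`: a map on `ℤ/N_mℤ` constant on the identified pairs. -/
def IsKFun (m : ℕ) (u : ZMod (Nm m) → ℝ) : Prop := ∀ n, u (partner m n) = u n

/-- The graph Laplacian `−Δ_m`. -/
def lap (m : ℕ) (u : ZMod (Nm m) → ℝ) : ZMod (Nm m) → ℝ := fun n =>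
  4 * u n - u (n + 1) - u (n - 1) - u (partner m n + 1) - u (partner m n - 1)

/-- `u` is a `λ`-eigenfunction of `−Δ_m`. -/
def IsEigen (m : ℕ) (lam : ℝ) (u : ZMod (Nm m) → ℝ) : Prop :=
  IsKFun m u ∧ u ≠ 0 ∧ ∀ n, lap m u n = lam * u n

/-- The spectral decimation renormalization polynomial `R(x) = x(3−x)(5−x)`. -/
def R (x : ℝ) : ℝ := x * (3 - x) * (5 - x)

/-- The `λ'`-extension of a function on `K_m` to a function on `K_{m+1}`. -/
def extFun (m : ℕ) (lam' : ℝ) (u : ZMod (Nm m) → ℝ) : ZMod (Nm (m + 1)) → ℝ := fun x =>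
  let n : ZMod (Nm m) := ((x.val / 5 : ℕ) : ZMod (Nm m))
  if x.val % 5 = 0 then u n
  else if x.val % 5 = 1 ∨ x.val % 5 = 2 then
    ((2 - lam') * u n + u (n + 1)) / ((1 - lam') * (3 - lam'))
  else
    (u n + (2 - lam') * u (n + 1)) / ((1 - lam') * (3 - lam'))

/-- Restriction of a function on `K_{m+1}` to the old vertices, giving a function on `K_m`. -/
def down (m : ℕ) (v : ZMod (Nm (m + 1)) → ℝ) : ZMod (Nm m) → ℝ := fun n =>
  v (((5 * n.val : ℕ) : ZMod (Nm (m + 1))))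

/-- The Laplacian `−Δ_m` as a linear map. -/
def lapL (m : ℕ) : (ZMod (Nm m) → ℝ) →ₗ[ℝ] (ZMod (Nm m) → ℝ) where
  toFun := lap m
  map_add' u v := by funext n; simp only [lap, Pi.add_apply]; ring
  map_smul' c u := by funext n; simp only [lap, Pi.smul_apply, smul_eq_mul, RingHom.id_apply]; ring

/-- The subspace of functions on `K_m` (maps constant on identified pairs). -/
def KFunSub (m : ℕ) : Submodule ℝ (ZMod (Nm m) → ℝ) where
  carrier := {u | IsKFun m u}
  add_mem' := by
    intro u v hu hv n
    simp only [Pi.add_apply, hu n, hv n]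
  zero_mem' := fun _ => rfl
  smul_mem' := by
    intro c u hu n
    simp only [Pi.smul_apply, hu n]

/-- The `λ`-eigenspace of `−Δ_m` inside the space of functions on `K_m`. -/
def eigensp (m : ℕ) (lam : ℝ) : Submodule ℝ (ZMod (Nm m) → ℝ) :=
  LinearMap.ker (lapL m - lam • LinearMap.id) ⊓ KFunSub m

/-- `c = (8 − √19)/3`, the smaller critical point of `R`. -/
def cpt : ℝ := (8 - Real.sqrt 19) / 3

/-- `φ₁`, the inverse of the (strictly increasing) restriction of `R` to `[0, c]`. -/
def phi1 : ℝ → ℝ := Function.invFunOn R (Set.Icc 0 cpt)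

/-- Eigenvalue counting function: total dimension of the eigenspaces of `−Δ_m`
with eigenvalue `≤ t`. -/
def evCount (m : ℕ) (t : ℝ) : ℕ :=
  Module.finrank ℝ ↥(⨆ lam ∈ Set.Iic t, eigensp m lam)

/-- `evSorted m k = λ_k(m)`, the `k`-th smallest eigenvalue (with multiplicity,
`1 ≤ k ≤ 5^m`) of `−Δ_m` acting on functions on `K_m`. -/
def evSorted (m k : ℕ) : ℝ := sInf {t : ℝ | k ≤ evCount m t}

/-- The restriction of a function on the circle `ℝ/ℤ` to the level-`m` vertices. -/
def restr (u : AddCircle (1 : ℝ) → ℝ) (m : ℕ) : ZMod (Nm m) → ℝ := fun n =>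
  u (((n.val : ℝ) / (Nm m : ℝ) : ℝ) : AddCircle (1 : ℝ))

/-- A continuous function on the circle is admissible if at every level its values
agree on identified pairs, so that its restrictions are functions on `K_m`. -/
def Admissible (u : AddCircle (1 : ℝ) → ℝ) : Prop :=
  Continuous u ∧ ∀ m, 1 ≤ m → ∀ n : ZMod (Nm m), restr u m (partner m n) = restr u m n

/-- `u` is a `λ`-eigenfunction of `−Δ` on `K`: it is admissible, nonzero, and
`sup_n |15^m (−Δ_m u_m)(n) − λ u(n/N_m)| → 0` as `m → ∞`. -/
def IsEigenK (lam : ℝ) (u : AddCircle (1 : ℝ) → ℝ) : Prop :=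
  Admissible u ∧ u ≠ 0 ∧
    ∀ ε : ℝ, 0 < ε → ∃ M : ℕ, ∀ m, M ≤ m → ∀ n : ZMod (Nm m),
      |(15 : ℝ) ^ m * lap m (restr u m) n - lam * restr u m n| < ε

/-- The symmetry-type subspace `V_{ε₁,ε₂}` of functions on `K_m`. -/
def symSub (m : ℕ) (e1 e2 : ℝ) : Submodule ℝ (ZMod (Nm m) → ℝ) where
  carrier := {u | IsKFun m u ∧ (∀ n, u (-n) = e1 * u n) ∧
    (∀ n, u (((5 ^ m : ℕ) : ZMod (Nm m)) - n) = e2 * u n)}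
  add_mem' := by
    rintro u v ⟨hu, hu1, hu2⟩ ⟨hv, hv1, hv2⟩
    refine ⟨fun n => by simp only [Pi.add_apply, hu n, hv n],
      fun n => by simp only [Pi.add_apply, hu1 n, hv1 n]; ring,
      fun n => by simp only [Pi.add_apply, hu2 n, hv2 n]; ring⟩
  zero_mem' := ⟨fun _ => rfl, fun n => by simp, fun n => by simp⟩
  smul_mem' := by
    rintro c u ⟨hu, hu1, hu2⟩
    refine ⟨fun n => by simp only [Pi.smul_apply, hu n],
      fun n => by simp only [Pi.smul_apply, smul_eq_mul, hu1 n]; ring,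
      fun n => by simp only [Pi.smul_apply, smul_eq_mul, hu2 n]; ring⟩

instance neZero_Nm (m : ℕ) : NeZero (Nm m) := ⟨by unfold Nm; positivity⟩

lemma Nm_succ (m : ℕ) : Nm (m + 1) = 5 * Nm m := by unfold Nm; ring

lemma intCast_five_mul_eq {m : ℕ} {a b : ℤ} (h : (a : ZMod (Nm m)) = b) :
    ((5 * a : ℤ) : ZMod (Nm (m + 1))) = ((5 * b : ℤ) : ZMod (Nm (m + 1))) := by
  rw [ZMod.intCast_eq_intCast_iff_dvd_sub] at h ⊢
  obtain ⟨c, hc⟩ := h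
  exact ⟨c, by rw [← mul_sub, hc, Nm_succ]; push_cast; ring⟩

lemma exists_nat_lt_Nm (m : ℕ) (n : ZMod (Nm m)) : ∃ j : ℕ, j < Nm m ∧ (j : ZMod (Nm m)) = n :=
  ⟨n.val, ZMod.val_lt n, ZMod.natCast_zmod_val n⟩

lemma exists_pos_nat_le_Nm (m : ℕ) (n : ZMod (Nm m)) :
    ∃ v : ℕ, 1 ≤ v ∧ v ≤ Nm m ∧ (v : ZMod (Nm m)) = n := by
  by_cases h : n.val = 0
  · refine ⟨Nm m, Nat.one_le_iff_ne_zero.2 (NeZero.ne _), le_rfl, ?_⟩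
    rw [ZMod.natCast_self, (ZMod.val_eq_zero n).1 h]
  · exact ⟨n.val, Nat.one_le_iff_ne_zero.2 h, (ZMod.val_lt n).le, ZMod.natCast_zmod_val n⟩

lemma down_intCast (m : ℕ) (f : ZMod (Nm (m + 1)) → ℝ) (a : ℤ) :
    down m f (a : ZMod (Nm m)) = f ((5 * a : ℤ) : ZMod (Nm (m + 1))) := by
  have h : (((a : ZMod (Nm m)).val : ℤ) : ZMod (Nm m)) = (a : ZMod (Nm m)) := by
    rw [Int.cast_natCast, ZMod.natCast_zmod_val]
  have h5 := intCast_five_mul_eq h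
  unfold down
  rw [← h5]
  push_cast
  rfl

/-- The displacement from the integer representative `v` to its partner. -/
def shift (v : ℕ) : ℤ :=
  if (v / 5 ^ padicValNat 5 v) % 5 = 1 ∨ (v / 5 ^ padicValNat 5 v) % 5 = 3 then
    5 ^ padicValNat 5 v
  else -5 ^ padicValNat 5 v

lemma partner_natCast {m v : ℕ} (h1 : 1 ≤ v) (h2 : v ≤ Nm m) :
    partner m (v : ZMod (Nm m)) = ((v + shift v : ℤ) : ZMod (Nm m)) := by
  have hv : (if (v : ZMod (Nm m)).val = 0 then Nm m else (v : ZMod (Nm m)).val) = v := by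
    rw [ZMod.val_natCast]
    rcases h2.eq_or_lt with h | h
    · rw [h]; simp
    · rw [Nat.mod_eq_of_lt h, if_neg (by omega)]
  unfold partner shift
  simp only [hv]
  split_ifs <;> push_cast <;> ring

lemma shift_five_mul {v : ℕ} (hv : 1 ≤ v) : shift (5 * v) = 5 * shift v := by
  have hp : Fact (Nat.Prime 5) := ⟨Nat.prime_five⟩
  have hk : padicValNat 5 (5 * v) = padicValNat 5 v + 1 := by
    rw [padicValNat.mul (by norm_num) (by omega), padicValNat_self, add_comm]
  have hd : 5 * v / 5 ^ (padicValNat 5 v + 1) = v / 5 ^ padicValNat 5 v := by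
    rw [pow_succ', Nat.mul_div_mul_left _ _ (by norm_num)]
  unfold shift
  rw [hk, hd]
  split_ifs <;> ring

lemma shift_of_mod_ne_zero {v : ℕ} (hv : v % 5 ≠ 0) :
    shift v = if v % 5 = 1 ∨ v % 5 = 3 then 1 else -1 := by
  have hk : padicValNat 5 v = 0 :=
    padicValNat.eq_zero_of_not_dvd fun h => hv (Nat.mod_eq_zero_of_dvd h)
  unfold shift
  simp [hk]

lemma partner_five_mul (m : ℕ) (n : ZMod (Nm m)) :
    ∃ a p : ℤ, (a : ZMod (Nm m)) = n ∧ partner m n = (p : ZMod (Nm m)) ∧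
      partner (m + 1) ((5 * a : ℤ) : ZMod (Nm (m + 1))) =
        ((5 * p : ℤ) : ZMod (Nm (m + 1))) := by
  obtain ⟨v, h1, h2, rfl⟩ := exists_pos_nat_le_Nm m n
  refine ⟨v, v + shift v, by simp, partner_natCast h1 h2, ?_⟩
  have h := partner_natCast (m := m + 1) (v := 5 * v) (by omega) (by rw [Nm_succ]; omega)
  rw [shift_five_mul h1] at h
  push_cast at h ⊢
  rw [h]
  ring

lemma partner_of_mod_ne_zero (m : ℕ) (j r : ℤ) (s : ℤ) (hr : r = 1 ∧ s = 2 ∨ r = 2 ∧ s = 1 ∨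
    r = 3 ∧ s = 4 ∨ r = 4 ∧ s = 3) :
    partner (m + 1) ((5 * j + r : ℤ) : ZMod (Nm (m + 1))) =
      ((5 * j + s : ℤ) : ZMod (Nm (m + 1))) := by
  obtain ⟨i, hi, hij⟩ := exists_nat_lt_Nm m (j : ZMod (Nm m))
  have h5 : ((5 * j : ℤ) : ZMod (Nm (m + 1))) = ((5 * i : ℤ) : ZMod (Nm (m + 1))) :=
    intCast_five_mul_eq (by rw [← hij, Int.cast_natCast])
  rw [Int.cast_add, Int.cast_add _ s, h5, ← Int.cast_add, ← Int.cast_add]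
  lift r to ℕ using (by omega)
  have h := partner_natCast (m := m + 1) (v := 5 * i + r) (by omega) (by rw [Nm_succ]; omega)
  rw [shift_of_mod_ne_zero (by omega)] at h
  have hs : (5 * i + s : ℤ) = ((5 * i + r : ℕ) : ℤ) +
      (if (5 * i + r) % 5 = 1 ∨ (5 * i + r) % 5 = 3 then 1 else -1) := by
    split_ifs <;> push_cast <;> omega
  rw [hs, ← h]
  push_cast
  rfl

section Decimation

variable {m : ℕ} {f : ZMod (Nm (m + 1)) → ℝ}

lemma IsKFun.interior_eq (hf : IsKFun (m + 1) f) (j : ℤ) :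
    f ((5 * j + 2 : ℤ)) = f ((5 * j + 1 : ℤ)) ∧ f ((5 * j + 3 : ℤ)) = f ((5 * j + 4 : ℤ)) := by
  constructor
  · rw [← partner_of_mod_ne_zero m j 1 2 (by omega), hf]
  · rw [← partner_of_mod_ne_zero m j 4 3 (by omega), hf]

lemma lap_intCast {k : ℕ} (g : ZMod (Nm k) → ℝ) {a p : ℤ}
    (h : partner k (a : ZMod (Nm k)) = (p : ZMod (Nm k))) :
    lap k g (a : ZMod (Nm k)) = 4 * g a - g ((a + 1 : ℤ)) - g ((a - 1 : ℤ)) -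
      g ((p + 1 : ℤ)) - g ((p - 1 : ℤ)) := by
  unfold lap
  rw [h]
  push_cast
  rfl

lemma IsKFun.lap_left (hf : IsKFun (m + 1) f) (j : ℤ) :
    lap (m + 1) f ((5 * j + 1 : ℤ)) =
      2 * f ((5 * j + 1 : ℤ)) - f ((5 * j : ℤ)) - f ((5 * j + 4 : ℤ)) := by
  rw [lap_intCast f (partner_of_mod_ne_zero m j 1 2 (by omega))]
  obtain ⟨h1, h2⟩ := hf.interior_eq j
  rw [show (5 * j + 1 + 1 : ℤ) = 5 * j + 2 by ring, show (5 * j + 1 - 1 : ℤ) = 5 * j by ring,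
    show (5 * j + 2 + 1 : ℤ) = 5 * j + 3 by ring, show (5 * j + 2 - 1 : ℤ) = 5 * j + 1 by ring,
    h1, h2]
  ring

lemma IsKFun.lap_right (hf : IsKFun (m + 1) f) (j : ℤ) :
    lap (m + 1) f ((5 * j + 4 : ℤ)) =
      2 * f ((5 * j + 4 : ℤ)) - f ((5 * j + 1 : ℤ)) - f ((5 * (j + 1) : ℤ)) := by
  rw [lap_intCast f (partner_of_mod_ne_zero m j 4 3 (by omega))]
  obtain ⟨h1, h2⟩ := hf.interior_eq j
  rw [show (5 * j + 4 + 1 : ℤ) = 5 * (j + 1) by ring,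
    show (5 * j + 4 - 1 : ℤ) = 5 * j + 3 by ring,
    show (5 * j + 3 + 1 : ℤ) = 5 * j + 4 by ring, show (5 * j + 3 - 1 : ℤ) = 5 * j + 2 by ring,
    h1, h2]
  ring

/-- Spectral decimation with an error term: the defect of `down m f` from being an
`R μ`-eigenfunction is a combination of the defects of `f` from being a `μ`-eigenfunction. -/
lemma IsKFun.lap_down_sub (hf : IsKFun (m + 1) f) (μ : ℝ) (n : ZMod (Nm m)) :
    ∃ x₀ x₁ x₂ x₃ x₄ y₁ y₂ y₃ y₄ : ZMod (Nm (m + 1)),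
      lap m (down m f) n - R μ * down m f n =
        (1 - μ) * (3 - μ) * (lap (m + 1) f x₀ - μ * f x₀) +
        (2 - μ) * (lap (m + 1) f x₁ - μ * f x₁) + (lap (m + 1) f y₁ - μ * f y₁) +
        (2 - μ) * (lap (m + 1) f x₂ - μ * f x₂) + (lap (m + 1) f y₂ - μ * f y₂) +
        (2 - μ) * (lap (m + 1) f x₃ - μ * f x₃) + (lap (m + 1) f y₃ - μ * f y₃) +
        (2 - μ) * (lap (m + 1) f x₄ - μ * f x₄) + (lap (m + 1) f y₄ - μ * f y₄) := by
  obtain ⟨a, p, rfl, hp, hp5⟩ := partner_five_mul m n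
  have hap : f ((5 * p : ℤ)) = f ((5 * a : ℤ)) := by rw [← hp5, hf]
  refine ⟨(5 * a : ℤ), (5 * a + 1 : ℤ), (5 * (a - 1) + 4 : ℤ), (5 * p + 1 : ℤ),
    (5 * (p - 1) + 4 : ℤ), (5 * a + 4 : ℤ), (5 * (a - 1) + 1 : ℤ), (5 * p + 4 : ℤ),
    (5 * (p - 1) + 1 : ℤ), ?_⟩
  rw [lap_intCast _ hp, lap_intCast f hp5, hf.lap_left, hf.lap_right, hf.lap_left, hf.lap_right,
    hf.lap_left, hf.lap_right, hf.lap_left, hf.lap_right]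
  simp only [down_intCast]
  rw [show (5 * a - 1 : ℤ) = 5 * (a - 1) + 4 by ring,
    show (5 * p - 1 : ℤ) = 5 * (p - 1) + 4 by ring, sub_add_cancel, sub_add_cancel, hap]
  unfold R
  ring

lemma lap_down_of_lap {μ : ℝ} (hf : IsKFun (m + 1) f) (h : ∀ x, lap (m + 1) f x = μ * f x)
    (n : ZMod (Nm m)) : lap m (down m f) n = R μ * down m f n := by
  obtain ⟨x₀, x₁, x₂, x₃, x₄, y₁, y₂, y₃, y₄, hx⟩ := hf.lap_down_sub μ n
  simp only [h, sub_self, mul_zero, add_zero] at hx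
  exact sub_eq_zero.1 hx

lemma abs_lap_down_sub_le {μ ε : ℝ} (hf : IsKFun (m + 1) f) (h0 : 0 ≤ μ) (h1 : μ ≤ 1)
    (h : ∀ x, |lap (m + 1) f x - μ * f x| ≤ ε) (n : ZMod (Nm m)) :
    |lap m (down m f) n - R μ * down m f n| ≤ 15 * ε := by
  obtain ⟨x₀, x₁, x₂, x₃, x₄, y₁, y₂, y₃, y₄, hx⟩ := hf.lap_down_sub μ n
  have hε : 0 ≤ ε := (abs_nonneg _).trans (h x₀)
  have hD : ∀ e : ℝ, |e| ≤ ε → |(1 - μ) * (3 - μ) * e| ≤ 3 * ε := fun e he => by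
    rw [abs_mul, abs_of_nonneg (mul_nonneg (by linarith) (by linarith))]
    exact mul_le_mul (by nlinarith) he (abs_nonneg _) (by norm_num)
  have h2 : ∀ e : ℝ, |e| ≤ ε → |(2 - μ) * e| ≤ 2 * ε := fun e he => by
    rw [abs_mul, abs_of_nonneg (by linarith : 0 ≤ 2 - μ)]
    exact mul_le_mul (by linarith) he (abs_nonneg _) (by norm_num)
  have a0 := abs_le.1 (hD _ (h x₀))
  have a1 := abs_le.1 (h2 _ (h x₁))
  have a2 := abs_le.1 (h2 _ (h x₂))
  have a3 := abs_le.1 (h2 _ (h x₃))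
  have a4 := abs_le.1 (h2 _ (h x₄))
  have b1 := abs_le.1 (h y₁)
  have b2 := abs_le.1 (h y₂)
  have b3 := abs_le.1 (h y₃)
  have b4 := abs_le.1 (h y₄)
  rw [hx, abs_le]
  constructor <;> linarith [a0.1, a0.2]

lemma eq_zero_of_down_eq_zero {μ : ℝ} (hf : IsKFun (m + 1) f)
    (h : ∀ x, lap (m + 1) f x = μ * f x) (hd : down m f = 0) (h1 : μ ≠ 1) (h3 : μ ≠ 3) :
    f = 0 := by
  have h5 (j : ℤ) : f ((5 * j : ℤ)) = 0 := by rw [← down_intCast m f, hd]; rfl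
  have hD : (1 - μ) * (3 - μ) ≠ 0 :=
    mul_ne_zero (sub_ne_zero.2 h1.symm) (sub_ne_zero.2 h3.symm)
  have hA (j : ℤ) : f ((5 * j + 1 : ℤ)) = 0 ∧ f ((5 * j + 4 : ℤ)) = 0 := by
    have e1 := h ((5 * j + 1 : ℤ))
    have e2 := h ((5 * j + 4 : ℤ))
    rw [hf.lap_left, h5] at e1
    rw [hf.lap_right, h5] at e2
    constructor
    · refine (mul_eq_zero.1 ?_).resolve_left hD
      linear_combination (2 - μ) * e1 + e2
    · refine (mul_eq_zero.1 ?_).resolve_left hD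
      linear_combination (2 - μ) * e2 + e1
  funext x
  obtain ⟨i, -, rfl⟩ := exists_nat_lt_Nm (m + 1) x
  have hi : (i : ZMod (Nm (m + 1))) = ((5 * ((i / 5 : ℕ) : ℤ) + ((i % 5 : ℕ) : ℤ) : ℤ)) := by
    rw [← Int.cast_natCast i]
    congr 1
    omega
  have hK := hf.interior_eq ((i / 5 : ℕ) : ℤ)
  have hA' := hA ((i / 5 : ℕ) : ℤ)
  have hr : i % 5 < 5 := Nat.mod_lt _ (by norm_num)
  rw [hi, Pi.zero_apply]
  generalize i % 5 = r at hr
  interval_cases r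
  · simpa using h5 ((i / 5 : ℕ) : ℤ)
  · exact hA'.1
  · exact hK.1.trans hA'.1
  · exact hK.2.trans hA'.2
  · exact hA'.2

end Decimation

section Restriction

variable {u : AddCircle (1 : ℝ) → ℝ}

lemma restr_intCast (u : AddCircle (1 : ℝ) → ℝ) (m : ℕ) (a : ℤ) :
    restr u m (a : ZMod (Nm m)) = u (((a : ℝ) / (Nm m : ℝ) : ℝ) : AddCircle (1 : ℝ)) := by
  have h : (((a : ZMod (Nm m)).val : ℤ) : ZMod (Nm m)) = (a : ZMod (Nm m)) := by
    rw [Int.cast_natCast, ZMod.natCast_zmod_val]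
  rw [ZMod.intCast_eq_intCast_iff_dvd_sub] at h
  obtain ⟨c, hc⟩ := h
  have hN : (Nm m : ℝ) ≠ 0 := Nat.cast_ne_zero.2 (NeZero.ne _)
  have ha : (a : ℝ) = ((a : ZMod (Nm m)).val : ℝ) + (Nm m : ℝ) * c := by
    have : a = ((a : ZMod (Nm m)).val : ℤ) + (Nm m : ℤ) * c := by linarith
    exact_mod_cast this
  have e : (a : ℝ) / (Nm m : ℝ) = ((a : ZMod (Nm m)).val : ℝ) / (Nm m : ℝ) + c • (1 : ℝ) := by
    rw [zsmul_eq_mul, mul_one]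
    nth_rewrite 1 [ha]
    field_simp
  unfold restr
  rw [e, AddCircle.coe_add, AddCircle.coe_zsmul, AddCircle.coe_period, smul_zero, add_zero]

lemma down_restr (u : AddCircle (1 : ℝ) → ℝ) (m : ℕ) :
    down m (restr u (m + 1)) = restr u m := by
  funext n
  obtain ⟨i, -, rfl⟩ := exists_nat_lt_Nm m n
  rw [← Int.cast_natCast i, down_intCast, restr_intCast, restr_intCast, Nm_succ]
  congr 2
  push_cast
  exact mul_div_mul_left _ _ (by norm_num)

lemma exists_restr_add_eq (u : AddCircle (1 : ℝ) → ℝ) (m : ℕ) (n : ZMod (Nm m)) (k : ℕ) :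
    ∃ x, restr u (m + k) x = restr u m n := by
  induction k with
  | zero => exact ⟨n, rfl⟩
  | succ k ih =>
    obtain ⟨x, hx⟩ := ih
    exact ⟨((5 * x.val : ℕ) : ZMod (Nm (m + k + 1))),
      (congrFun (down_restr u (m + k)) x).trans hx⟩

lemma exists_restr_ne_zero (hc : Continuous u) (hu : u ≠ 0) :
    ∃ m n, restr u m n ≠ 0 := by
  by_contra! h
  apply hu
  funext p
  induction p using QuotientAddGroup.induction_on with
  | H t =>
    have hN : Filter.Tendsto (fun m => (Nm m : ℝ)) Filter.atTop Filter.atTop := by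
      unfold Nm
      push_cast
      exact (tendsto_pow_atTop_atTop_of_one_lt (by norm_num)).const_mul_atTop (by norm_num)
    have ht : Filter.Tendsto (fun m => (⌊t * (Nm m : ℝ)⌋ : ℝ) / (Nm m : ℝ)) Filter.atTop
        (nhds t) := by
      have hlow : Filter.Tendsto (fun m => t - (Nm m : ℝ)⁻¹) Filter.atTop (nhds t) := by
        simpa using (tendsto_inv_atTop_zero.comp hN).const_sub t
      have hpos (m : ℕ) : (0 : ℝ) < Nm m := Nat.cast_pos.2 (NeZero.pos _)
      refine tendsto_of_tendsto_of_tendsto_of_le_of_le hlow tendsto_const_nhds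
        (fun m => ?_) fun m => (div_le_iff₀ (hpos m)).2 (Int.floor_le _)
      rw [le_div_iff₀ (hpos m), sub_mul, inv_mul_cancel₀ (hpos m).ne']
      exact (Int.sub_one_lt_floor _).le
    have hcont : Continuous fun s : ℝ => u (s : AddCircle (1 : ℝ)) :=
      hc.comp (AddCircle.continuous_mk' 1)
    have hlim := (hcont.tendsto t).comp ht
    have hz : ((fun s : ℝ => u (s : AddCircle (1 : ℝ))) ∘
        fun m => (⌊t * (Nm m : ℝ)⌋ : ℝ) / (Nm m : ℝ)) = fun _ => 0 := by
      funext m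
      exact (restr_intCast u m _).symm.trans (h m _)
    rw [hz] at hlim
    exact tendsto_nhds_unique hlim tendsto_const_nhds

end Restriction

lemma R_nonneg {x : ℝ} (h0 : 0 ≤ x) (h1 : x ≤ 1) : 0 ≤ R x :=
  mul_nonneg (mul_nonneg h0 (by linarith)) (by linarith)

lemma R_le {x : ℝ} (h0 : 0 ≤ x) (h1 : x ≤ 1) : R x ≤ 15 * x := by
  unfold R
  nlinarith [mul_nonneg h0 h0, mul_nonneg (mul_nonneg h0 h0) (by linarith : 0 ≤ 8 - x)]

lemma R_iterate_mem (k : ℕ) : ∀ {x : ℝ}, 0 ≤ x → 15 ^ k * x ≤ 1 →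
    0 ≤ R^[k] x ∧ R^[k] x ≤ 15 ^ k * x := by
  induction k with
  | zero => intro x h0 h1; simpa using h0
  | succ k ih =>
    intro x h0 h1
    have hx : x ≤ 1 := (le_mul_of_one_le_left h0 (one_le_pow₀ (by norm_num))).trans h1
    have hR := R_le h0 hx
    have hk : (15 : ℝ) ^ k * R x ≤ 15 ^ (k + 1) * x := by
      rw [pow_succ, mul_assoc]
      gcongr
    have := ih (R_nonneg h0 hx) (hk.trans h1)
    exact ⟨this.1, this.2.trans hk⟩

lemma phi1_R {x : ℝ} (hx : x ∈ Set.Icc 0 cpt) : phi1 (R x) = x := by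
  have hs : Real.sqrt 19 ^ 2 = 19 := Real.sq_sqrt (by norm_num)
  have hs0 : 4 ≤ Real.sqrt 19 := Real.le_sqrt_of_sq_le (by norm_num)
  have hc : 3 * cpt ^ 2 - 16 * cpt + 15 = 0 := by
    unfold cpt
    linear_combination hs / 3
  have hc2 : cpt ≤ 4 / 3 := by unfold cpt; linarith
  have key {a b : ℝ} (hab : a < b) (hb : b ≤ cpt) : R a < R b := by
    have : 0 < a ^ 2 + a * b + b ^ 2 - 8 * (a + b) + 15 := by
      nlinarith [mul_nonneg (sub_nonneg.2 hb) (sub_nonneg.2 (hab.le.trans hb)),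
        sq_nonneg (cpt - a), sq_nonneg (cpt - b)]
    have := mul_pos (sub_pos.2 hab) this
    unfold R
    nlinarith
  have hinj : Set.InjOn R (Set.Icc 0 cpt) := by
    intro a ha b hb h
    rcases lt_trichotomy a b with hab | hab | hab
    · exact absurd h (key hab hb.2).ne
    · exact hab
    · exact absurd h (key hab ha.2).ne'
  exact hinj.leftInvOn_invFunOn hx

lemma abs_lap_restr_sub_le {u : AddCircle (1 : ℝ) → ℝ} (hu : Admissible u) {m : ℕ} (k : ℕ) :
    ∀ {μ ε : ℝ}, 0 ≤ μ → 15 ^ k * μ ≤ 1 →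
      (∀ x, |lap (m + k) (restr u (m + k)) x - μ * restr u (m + k) x| ≤ ε) →
      ∀ n, |lap m (restr u m) n - R^[k] μ * restr u m n| ≤ 15 ^ k * ε := by
  induction k with
  | zero => intro μ ε _ _ h n; simpa using h n
  | succ k ih =>
    intro μ ε h0 h1 h n
    have hμ : μ ≤ 1 := (le_mul_of_one_le_left h0 (one_le_pow₀ (by norm_num))).trans h1
    have hk : (15 : ℝ) ^ k * R μ ≤ 15 ^ (k + 1) * μ := by
      rw [pow_succ, mul_assoc]
      gcongr
      exact R_le h0 hμ
    have hd := abs_lap_down_sub_le (hu.2 (m + k + 1) (by omega)) h0 hμ h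
    rw [down_restr] at hd
    have := ih (R_nonneg h0 hμ) (hk.trans h1) hd n
    rwa [← mul_assoc, ← pow_succ] at this

lemma mul_lap_nonneg {m : ℕ} {f : ZMod (Nm m) → ℝ} {n : ZMod (Nm m)}
    (h : ∀ x, |f x| ≤ |f n|) : 0 ≤ f n * lap m f n := by
  have key (x : ZMod (Nm m)) : f n * f x ≤ f n * f n := by
    calc f n * f x ≤ |f n| * |f x| := by rw [← abs_mul]; exact le_abs_self _
      _ ≤ |f n| * |f n| := mul_le_mul_of_nonneg_left (h x) (abs_nonneg _)
      _ = f n * f n := abs_mul_abs_self _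
  unfold lap
  nlinarith [key (n + 1), key (n - 1), key (partner m n + 1), key (partner m n - 1)]

lemma IsEigenK.nonneg {lam : ℝ} {u : AddCircle (1 : ℝ) → ℝ} (hu : IsEigenK lam u) :
    0 ≤ lam := by
  obtain ⟨⟨hc, -⟩, hne, hlim⟩ := hu
  obtain ⟨m, n, hn⟩ := exists_restr_ne_zero hc hne
  by_contra! hlam
  have hδ : 0 < |restr u m n| := abs_pos.2 hn
  obtain ⟨M, hM⟩ := hlim (-lam * |restr u m n|) (mul_pos (by linarith) hδ)
  obtain ⟨x, hx⟩ := exists_restr_add_eq u m n M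
  obtain ⟨y, hy⟩ := Finite.exists_max fun z => |restr u (m + M) z|
  have hyM := hM (m + M) (by omega) y
  have hle : |restr u m n| ≤ |restr u (m + M) y| := hx ▸ hy x
  have h1 := mul_lap_nonneg hy
  set v := restr u (m + M) y
  set L := lap (m + M) (restr u (m + M)) y
  have h2 : -lam * |v| * |v| ≤ |15 ^ (m + M) * L - lam * v| * |v| := by
    rw [← abs_mul, mul_assoc, abs_mul_abs_self]
    refine le_trans ?_ (le_abs_self _)
    have : (0 : ℝ) ≤ 15 ^ (m + M) * (v * L) := mul_nonneg (by positivity) h1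
    nlinarith
  have h3 := le_of_mul_le_mul_right h2 (hδ.trans_le hle)
  nlinarith

/-- At every sufficiently fine level where it does not vanish, the restriction of an
eigenfunction on `K` is an eigenfunction of the graph Laplacian. -/
lemma IsEigenK.exists_isEigen {lam : ℝ} {u : AddCircle (1 : ℝ) → ℝ} (hu : IsEigenK lam u)
    {m : ℕ} (hm : 1 ≤ m) (hlam : lam / 15 ^ m ≤ 1) (hne : restr u m ≠ 0) :
    ∃ μ, 0 ≤ μ ∧ μ ≤ 1 ∧ IsEigen m μ (restr u m) := by
  have h0 := hu.nonneg
  obtain ⟨hadm, -, hlim⟩ := hu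
  have hmul (k : ℕ) : (15 : ℝ) ^ k * (lam / 15 ^ (m + k)) = lam / 15 ^ m := by
    rw [pow_add]; field_simp
  have hmem (k : ℕ) := R_iterate_mem k (x := lam / 15 ^ (m + k)) (by positivity)
    ((hmul k).le.trans hlam)
  have ht (n : ZMod (Nm m)) : Filter.Tendsto
      (fun k => R^[k] (lam / 15 ^ (m + k)) * restr u m n) Filter.atTop
      (nhds (lap m (restr u m) n)) := by
    rw [Metric.tendsto_atTop]
    intro ε hε
    obtain ⟨M, hM⟩ := hlim (ε / 2) (by positivity)
    refine ⟨M, fun k hk => ?_⟩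
    have hb : ∀ x, |lap (m + k) (restr u (m + k)) x -
        lam / 15 ^ (m + k) * restr u (m + k) x| ≤ ε / 2 / 15 ^ (m + k) := by
      intro x
      rw [le_div_iff₀ (by positivity)]
      refine le_trans (le_of_eq ?_) (hM (m + k) (by omega) x).le
      rw [← abs_of_pos (show (0 : ℝ) < 15 ^ (m + k) by positivity), ← abs_mul,
        abs_of_pos (show (0 : ℝ) < 15 ^ (m + k) by positivity)]
      congr 1
      field_simp
    have h := abs_lap_restr_sub_le hadm k (by positivity) ((hmul k).le.trans hlam) hb n
    rw [dist_comm, Real.dist_eq]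
    refine h.trans_lt ?_
    rw [pow_add]
    have : (15 : ℝ) ^ k * (ε / 2 / (15 ^ m * 15 ^ k)) = ε / 2 / 15 ^ m := by field_simp
    rw [this]
    exact (div_le_self (by positivity) (one_le_pow₀ (by norm_num))).trans_lt (by linarith)
  obtain ⟨n₀, hn₀⟩ := Function.ne_iff.1 hne
  rw [Pi.zero_apply] at hn₀
  have hR : Filter.Tendsto (fun k => R^[k] (lam / 15 ^ (m + k))) Filter.atTop
      (nhds (lap m (restr u m) n₀ / restr u m n₀)) := by
    simpa [mul_div_cancel_right₀ _ hn₀] using (ht n₀).div_const (restr u m n₀)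
  refine ⟨_, ge_of_tendsto' hR fun k => (hmem k).1,
    le_of_tendsto' hR fun k => (hmem k).2.trans ((hmul k).le.trans hlam),
    hadm.2 m hm, hne, fun n => tendsto_nhds_unique (ht n) (hR.mul_const _)⟩

lemma IsEigen.eq_of_lap {m : ℕ} {μ ν : ℝ} {f : ZMod (Nm m) → ℝ} (h : IsEigen m μ f)
    (h' : ∀ n, lap m f n = ν * f n) : μ = ν := by
  obtain ⟨n, hn⟩ := Function.ne_iff.1 h.2.1
  exact mul_right_cancel₀ hn ((h.2.2 n).symm.trans (h' n))

lemma IsEigen.lap_restr {m : ℕ} {μ : ℝ} {u : AddCircle (1 : ℝ) → ℝ}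
    (h : IsEigen (m + 1) μ (restr u (m + 1))) (n : ZMod (Nm m)) :
    lap m (restr u m) n = R μ * restr u m n := by
  rw [← down_restr u m]
  exact lap_down_of_lap h.1 h.2.2 n

lemma lap_restr_zero {u : AddCircle (1 : ℝ) → ℝ} (hu : Admissible u) (n : ZMod (Nm 0)) :
    lap 0 (restr u 0) n = 0 := by
  have hp : partner 1 ((5 : ℕ) : ZMod (Nm 1)) = ((5 * 2 : ℤ) : ZMod (Nm 1)) := by
    rw [partner_natCast (by norm_num) (by norm_num [Nm]), ← mul_one 5, shift_five_mul le_rfl,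
      shift_of_mod_ne_zero (by norm_num)]
    norm_num
  have h10 : restr u 0 (1 : ZMod (Nm 0)) = restr u 0 (0 : ZMod (Nm 0)) := by
    have h := hu.2 1 le_rfl (5 : ℕ)
    rw [hp, ← down_intCast 0 (restr u 1), down_restr] at h
    have h5 : restr u 1 ((5 : ℕ) : ZMod (Nm 1)) = restr u 0 ((1 : ℤ) : ZMod (Nm 0)) := by
      rw [← down_restr u 0, down_intCast]
      norm_num
    rw [h5, Int.cast_one, show ((2 : ℤ) : ZMod (Nm 0)) = 0 from rfl] at h
    exact h.symm
  have hconst (x : ZMod (Nm 0)) : restr u 0 x = restr u 0 0 := by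
    obtain ⟨i, hi, rfl⟩ := exists_nat_lt_Nm 0 x
    have hi2 : i < 2 := hi
    interval_cases i
    · simp
    · simpa using h10
  simp only [lap, hconst]
  ring

/-- If `u` is a `λ`-eigenfunction of `−Δ` on `K`, then there is a
(minimal) `m₀ ≥ 1` such that for all `m ≥ m₀` the restriction `u_m` is a
`λ_m`-eigenfunction of `−Δ_m`, with `λ_m = R(λ_{m+1})`, `λ = lim_m 15^m λ_m`,
`λ_{m+1} = φ₁(λ_m)` for all `m ≥ m₁` (some `m₁`), and `λ_{m₀} ∈ {0,1,3,5}` if `m₀ = 1`,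
`λ_{m₀} ∈ {1,3}` if `m₀ > 1`. -/
theorem eigenfunction_on_K_structure (lam : ℝ) (u : AddCircle (1 : ℝ) → ℝ)
    (hu : IsEigenK lam u) :
    ∃ m₀ : ℕ, 1 ≤ m₀ ∧ ∃ lamSeq : ℕ → ℝ,
      (∀ m, m₀ ≤ m → IsEigen m (lamSeq m) (restr u m)) ∧
      (∀ m, m₀ ≤ m → lamSeq m = R (lamSeq (m + 1))) ∧
      Filter.Tendsto (fun m => (15 : ℝ) ^ m * lamSeq m) Filter.atTop (nhds lam) ∧
      (∃ m₁, m₀ ≤ m₁ ∧ ∀ m, m₁ ≤ m → lamSeq (m + 1) = phi1 (lamSeq m)) ∧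
      (∀ m', 1 ≤ m' → (∀ m, m' ≤ m → ∃ μ, IsEigen m μ (restr u m)) → m₀ ≤ m') ∧
      (m₀ = 1 → lamSeq m₀ ∈ ({0, 1, 3, 5} : Set ℝ)) ∧
      (1 < m₀ → lamSeq m₀ ∈ ({1, 3} : Set ℝ)) := by
  classical
  have h0 := hu.nonneg
  obtain ⟨m₁, n₁, hn₁⟩ := exists_restr_ne_zero hu.1.1 hu.2.1
  have hpers (m : ℕ) (hm : m₁ ≤ m) : ∃ x, restr u m x = restr u m₁ n₁ := by
    obtain ⟨k, rfl⟩ := Nat.exists_eq_add_of_le hm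
    exact exists_restr_add_eq u m₁ n₁ k
  obtain ⟨K, hK⟩ := pow_unbounded_of_one_lt lam (by norm_num : (1 : ℝ) < 15)
  have hfine (m : ℕ) (hm : m₁ + K + 1 ≤ m) :
      ∃ μ, 0 ≤ μ ∧ μ ≤ 1 ∧ IsEigen m μ (restr u m) := by
    refine hu.exists_isEigen (by omega) ?_ ?_
    · rw [div_le_one (by positivity)]
      exact hK.le.trans (pow_le_pow_right₀ (by norm_num) (by omega))
    · obtain ⟨x, hx⟩ := hpers m (by omega)
      exact fun h => hn₁ (by rw [← hx, h]; rfl)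
  have hex : ∃ m', 1 ≤ m' ∧ ∀ m, m' ≤ m → ∃ μ, IsEigen m μ (restr u m) :=
    ⟨m₁ + K + 1, by omega, fun m hm => (hfine m hm).imp fun _ h => h.2.2⟩
  obtain ⟨hm₀, hall⟩ := Nat.find_spec hex
  have hmin := fun m' => Nat.find_min' hex (m := m')
  set m₀ := Nat.find hex
  choose! l hl using hall
  have hrec (m : ℕ) (hm : m₀ ≤ m) : l m = R (l (m + 1)) :=
    (hl m hm).eq_of_lap (hl (m + 1) (by omega)).lap_restr
  have hD {j : ℕ} (hj : j + 1 = m₀) (hz : restr u j = 0) : l m₀ = 1 ∨ l m₀ = 3 := by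
    have hlj := hl m₀ le_rfl
    rw [← hj] at hlj ⊢
    by_contra! hne
    exact hlj.2.1 (eq_zero_of_down_eq_zero hlj.1 hlj.2.2 (by rw [down_restr, hz]) hne.1 hne.2)
  refine ⟨m₀, hm₀, l, hl, hrec, ?_, ?_, fun m' h1 h2 => hmin m' ⟨h1, h2⟩, ?_, ?_⟩
  · rw [Metric.tendsto_atTop]
    intro ε hε
    obtain ⟨M, hM⟩ := hu.2.2 (ε * |restr u m₁ n₁|) (mul_pos hε (abs_pos.2 hn₁))
    refine ⟨m₁ + m₀ + M, fun m hm => ?_⟩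
    obtain ⟨x, hx⟩ := hpers m (by omega)
    have h := hM m (by omega) x
    rw [(hl m (by omega)).2.2, ← mul_assoc, ← sub_mul, hx, abs_mul] at h
    exact lt_of_mul_lt_mul_right h (abs_nonneg _)
  · refine ⟨m₁ + K + 1 + m₀, by omega, fun m hm => ?_⟩
    obtain ⟨μ, hμ0, hμ1, hμ⟩ := hfine (m + 1) (by omega)
    rw [hrec m (by omega), (hl (m + 1) (by omega)).eq_of_lap hμ.2.2]
    refine (phi1_R ⟨hμ0, hμ1.trans ?_⟩).symm
    have hs : Real.sqrt 19 ≤ 5 := Real.sqrt_le_iff.2 (by norm_num)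
    unfold cpt
    linarith
  · intro h
    by_cases hz : restr u 0 = 0
    · rcases hD h.symm hz with h' | h' <;> simp [h']
    · obtain ⟨n, hn⟩ := Function.ne_iff.1 hz
      have hl1 := hl m₀ le_rfl
      rw [h] at hl1 ⊢
      have hR := hl1.lap_restr n
      rw [lap_restr_zero hu.1, eq_comm, mul_eq_zero, or_iff_left (by exact hn)] at hR
      unfold R at hR
      rcases mul_eq_zero.1 hR with hR | hR
      · rcases mul_eq_zero.1 hR with hR | hR
        · simp [hR]
        · simp [show l 1 = 3 by linarith]
      · simp [show l 1 = 5 by linarith]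
  · intro h
    obtain ⟨j, hj⟩ : ∃ j, m₀ = j + 1 := ⟨m₀ - 1, by omega⟩
    refine hD hj.symm ?_
    by_contra hz
    have hlj := hl m₀ le_rfl
    rw [hj] at hlj
    have := hmin j ⟨by omega, fun m hm => ?_⟩
    · omega
    · rcases hm.eq_or_lt with rfl | hm
      · exact ⟨_, hu.1.2 j (by omega), hz, hlj.lap_restr⟩
      · exact ⟨l m, hl m (by omega)⟩

end VNLE
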